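/- Let a > 0 and let G : (e^{-a}, 1) → (−∞, 0) be a C² function with G'(r) > 0 for all r ∈ (e^{-a}, 1), G(r) → −∞ as r → e^{-a}⁺, satisfying G''(r) + G'(r)/r − G'(r)²/G(r) + 1/(r²·G(r)) = 0 on (e^{-a}, 1). Then there exists a constant c₁ ≥ 0 such that r·G'(r) = √(1 + c₁·G(r)²) for all r ∈ (e^{-a}, 1). -/

import Mathlib

open Real Set Filter Topology

/-- The derivative of the first integral of the reduced harmonic map equation vanishes. -/
theorem hasDerivAt_first_integral {G : ℝ → ℝ} {r : ℝ} (hr : r ≠ 0) (hG : G r ≠ 0)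
    (hC2 : ContDiffAt ℝ 2 G r)
    (hode : deriv (deriv G) r + deriv G r / r - (deriv G r) ^ 2 / G r +
      1 / (r ^ 2 * G r) = 0) :
    HasDerivAt (fun x => ((x * deriv G x) ^ 2 - 1) / (G x) ^ 2) 0 r := by
  have h₁ : HasDerivAt G (deriv G r) r := (hC2.differentiableAt (by norm_num)).hasDerivAt
  have h₂ : HasDerivAt (deriv G) (deriv (deriv G) r) r :=
    ((hC2.derivWithin (m := 1) (by norm_num)).differentiableAt (by norm_num)).hasDerivAt
  have h₃ := ((((hasDerivAt_id r).mul h₂).pow 2).sub_const 1).div (h₁.pow 2) (pow_ne_zero 2 hG)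
  refine h₃.congr_deriv ?_
  have hG'' : deriv (deriv G) r =
      (deriv G r) ^ 2 / G r - 1 / (r ^ 2 * G r) - deriv G r / r := by linarith
  simp only [hG'', Pi.mul_apply, Pi.pow_apply, id]
  field_simp
  ring

theorem stmt_5 (a : ℝ) (ha : 0 < a) (G : ℝ → ℝ)
    (hC2 : ContDiffOn ℝ 2 G (Ioo (Real.exp (-a)) 1))
    (hneg : ∀ r ∈ Ioo (Real.exp (-a)) 1, G r < 0)
    (hG' : ∀ r ∈ Ioo (Real.exp (-a)) 1, 0 < deriv G r)
    (hlim : Tendsto G (𝓝[>] (Real.exp (-a))) atBot)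
    (hode : ∀ r ∈ Ioo (Real.exp (-a)) 1,
      deriv (deriv G) r + deriv G r / r - (deriv G r) ^ 2 / G r +
        1 / (r ^ 2 * G r) = 0) :
    ∃ c₁ : ℝ, 0 ≤ c₁ ∧ ∀ r ∈ Ioo (Real.exp (-a)) 1,
      r * deriv G r = Real.sqrt (1 + c₁ * (G r) ^ 2) := by
  have hpos : ∀ r ∈ Ioo (Real.exp (-a)) 1, 0 < r := fun r hr => (Real.exp_pos _).trans hr.1
  have hderiv : ∀ r ∈ Ioo (Real.exp (-a)) 1,
      HasDerivAt (fun x => ((x * deriv G x) ^ 2 - 1) / (G x) ^ 2) 0 r := fun r hr =>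
    hasDerivAt_first_integral (hpos r hr).ne' (hneg r hr).ne
      (hC2.contDiffAt (isOpen_Ioo.mem_nhds hr)) (hode r hr)
  obtain ⟨c, hc⟩ := isOpen_Ioo.exists_is_const_of_deriv_eq_zero isPreconnected_Ioo
    (fun r hr => (hderiv r hr).differentiableAt.differentiableWithinAt)
    (fun r hr => (hderiv r hr).deriv)
  have hsq : ∀ r ∈ Ioo (Real.exp (-a)) 1, (r * deriv G r) ^ 2 = 1 + c * (G r) ^ 2 := by
    intro r hr
    have h := (div_eq_iff (pow_ne_zero 2 (hneg r hr).ne)).1 (hc r hr)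
    linarith
  refine ⟨c, ?_, fun r hr => ?_⟩
  · by_contra! hc_neg
    have hG_sq : Tendsto (fun r => (G r) ^ 2) (𝓝[>] (Real.exp (-a))) atTop := by
      simpa only [pow_two] using hlim.atBot_mul_atBot₀ hlim
    have hbound : Tendsto (fun r => 1 + c * (G r) ^ 2) (𝓝[>] (Real.exp (-a))) atBot :=
      tendsto_atBot_add_const_left _ _
        (hG_sq.const_mul_atTop_of_neg hc_neg)
    have hmem : Ioo (Real.exp (-a)) 1 ∈ 𝓝[>] (Real.exp (-a)) :=
      Ioo_mem_nhdsGT (Real.exp_lt_one_iff.2 (by linarith))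
    obtain ⟨r, hr, hlt⟩ :=
      ((eventually_mem_set.2 hmem).and (hbound.eventually_lt_atBot 0)).exists
    have := hsq r hr
    nlinarith [sq_nonneg (r * deriv G r)]
  · rw [← hsq r hr, Real.sqrt_sq (mul_pos (hpos r hr) (hG' r hr)).le]
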